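/- arXiv:2507.21292 — 4 statements merged into one kernel-verified Lean document; each statement's English description precedes it below -/
import Mathlib

section
/- For every T ∈ R(V) the components of Sch(T) with respect to u satisfy: tr_γ (Sch(T)^∥) = Scal(T^∥)/(2(n−2)); Sch(T)^⊥ = (1/(n−1)) (Z_tr − ε Scal(T^∥)/(2(n−2))); hat(Sch(T)^∥) = (1/(n−2)) (ε T̂^⊥ + hat(Ric(T^∥))); and Sch(T)^{⊥∥} = −(1/(n−2)) V_tr. -/
open scoped BigOperators

noncomputable section

namespace Decomp

abbrev Vec (n : ℕ) := Fin n → ℝ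
abbrev Ten2 (n : ℕ) := Fin n → Fin n → ℝ
abbrev Ten3 (n : ℕ) := Fin n → Fin n → Fin n → ℝ
abbrev Ten4 (n : ℕ) := Fin n → Fin n → Fin n → Fin n → ℝ

variable {n : ℕ}

/-- A (0,4)-tensor with the algebraic symmetries of a Riemann tensor. -/
def IsRiemannType (T : Ten4 n) : Prop :=
  (∀ α β μ ν, T α β μ ν = - T α β ν μ) ∧
  (∀ α β μ ν, T α β μ ν = - T β α μ ν) ∧
  (∀ α β μ ν, T α β μ ν = T μ ν α β) ∧
  (∀ α β μ ν, T α β μ ν + T α μ ν β + T α ν β μ = 0)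

/-- A (0,3)-tensor antisymmetric in the last two indices with vanishing cyclic sum. -/
def IsLambda12 (F : Ten3 n) : Prop :=
  (∀ α μ ν, F α μ ν = - F α ν μ) ∧
  (∀ α μ ν, F α μ ν + F μ ν α + F ν α μ = 0)

def IsSym2 (S : Ten2 n) : Prop := ∀ α β, S α β = S β α

/-- Ricci-type trace of a (0,4)-tensor (first and third indices, using the inverse metric). -/
def RicT (ginv : Ten2 n) (T : Ten4 n) : Ten2 n :=
  fun β ν => ∑ α, ∑ μ, ginv α μ * T α β μ ν

/-- Scalar-type trace. -/
def ScalT (ginv : Ten2 n) (T : Ten4 n) : ℝ :=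
  ∑ β, ∑ ν, ginv β ν * RicT ginv T β ν

/-- Weyl-type: Riemann-type and trace-free in the first and third indices. -/
def IsWeylType (ginv : Ten2 n) (T : Ten4 n) : Prop :=
  IsRiemannType T ∧ ∀ β ν, RicT ginv T β ν = 0

/-- Kulkarni–Nomizu product. -/
def KN (A B : Ten2 n) : Ten4 n := fun α β μ ν =>
  A α μ * B β ν - A α ν * B β μ - A β μ * B α ν + A β ν * B α μ

/-- (u ⊛ F) for a one-form w and F ∈ Λ^{(1,2)}. -/
def circ (w : Vec n) (F : Ten3 n) : Ten4 n := fun α β μ ν =>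
  w α * F β μ ν - w β * F α μ ν + w μ * F ν α β - w ν * F μ α β

/-- Lower an index with the metric. -/
def lower (g : Ten2 n) (u : Vec n) : Vec n := fun α => ∑ β, g α β * u β

/-- Projector orthogonal to `u`, both indices covariant: γ_{αβ} = g_{αβ} − ε u_α u_β. -/
def gam (g : Ten2 n) (ε : ℝ) (u : Vec n) : Ten2 n := fun α β =>
  g α β - ε * lower g u α * lower g u β

/-- Mixed projector γ^κ_μ = δ^κ_μ − ε u^κ u_μ. -/
def gamMix (g : Ten2 n) (ε : ℝ) (u : Vec n) : Ten2 n := fun κ μ =>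
  (if κ = μ then (1 : ℝ) else 0) - ε * u κ * lower g u μ

/-- Contravariant projector γ^{αβ} = g^{αβ} − ε u^α u^β. -/
def gamUp (ginv : Ten2 n) (ε : ℝ) (u : Vec n) : Ten2 n := fun α β =>
  ginv α β - ε * u α * u β

/-- η := u⊗u − (ε/(n−3)) γ. -/
def eta (g : Ten2 n) (ε : ℝ) (u : Vec n) : Ten2 n := fun α β =>
  lower g u α * lower g u β - (ε / ((n : ℝ) - 3)) * gam g ε u α β

/-- T^⊥_{βν} := u^α u^μ T_{αβμν}. -/
def perp (u : Vec n) (T : Ten4 n) : Ten2 n := fun β ν =>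
  ∑ α, ∑ μ, u α * u μ * T α β μ ν

/-- T^{⊥∥}_{βμν} := u^α γ^κ_μ γ^σ_ν T_{αβκσ}. -/
def perppar (g : Ten2 n) (ε : ℝ) (u : Vec n) (T : Ten4 n) : Ten3 n := fun β μ ν =>
  ∑ α, ∑ κ, ∑ σ, u α * gamMix g ε u κ μ * gamMix g ε u σ ν * T α β κ σ

/-- T^∥ : projection of T with γ in all four indices. -/
def par4 (g : Ten2 n) (ε : ℝ) (u : Vec n) (T : Ten4 n) : Ten4 n := fun α β μ ν =>
  ∑ ρ, ∑ σ, ∑ κ, ∑ δ,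
    gamMix g ε u ρ α * gamMix g ε u σ β * gamMix g ε u κ μ * gamMix g ε u δ ν * T ρ σ κ δ

/-- T^{∥u} := T^∥ + (ε/(n−3)) T^⊥ ∧ γ. -/
def parU (g : Ten2 n) (ε : ℝ) (u : Vec n) (T : Ten4 n) : Ten4 n := fun α β μ ν =>
  par4 g ε u T α β μ ν + (ε / ((n : ℝ) - 3)) * KN (perp u T) (gam g ε u) α β μ ν

/-- Complete orthogonality to `u` for (0,2)-tensors. -/
def Orth2 (u : Vec n) (S : Ten2 n) : Prop :=
  (∀ β, (∑ α, u α * S α β) = 0) ∧ (∀ β, (∑ α, u α * S β α) = 0)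

/-- Complete orthogonality to `u` for (0,3)-tensors. -/
def Orth3 (u : Vec n) (F : Ten3 n) : Prop :=
  (∀ μ ν, (∑ α, u α * F α μ ν) = 0) ∧ (∀ μ ν, (∑ α, u α * F μ α ν) = 0) ∧
    (∀ μ ν, (∑ α, u α * F μ ν α) = 0)

/-- Complete orthogonality to `u` for (0,4)-tensors. -/
def Orth4 (u : Vec n) (T : Ten4 n) : Prop :=
  (∀ β μ ν, (∑ α, u α * T α β μ ν) = 0) ∧ (∀ β μ ν, (∑ α, u α * T β α μ ν) = 0) ∧
    (∀ β μ ν, (∑ α, u α * T β μ α ν) = 0) ∧ (∀ β μ ν, (∑ α, u α * T β μ ν α) = 0)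

/-- tr_γ of a (0,2)-tensor. -/
def trGam (ginv : Ten2 n) (ε : ℝ) (u : Vec n) (S : Ten2 n) : ℝ :=
  ∑ α, ∑ β, gamUp ginv ε u α β * S α β

/-- Schouten-type tensor of a (0,4)-tensor. -/
def SchT (g ginv : Ten2 n) (T : Ten4 n) : Ten2 n := fun β ν =>
  (1 / ((n : ℝ) - 2)) * (RicT ginv T β ν - ScalT ginv T / (2 * ((n : ℝ) - 1)) * g β ν)

/-- Weyl-type part of a (0,4)-tensor: Weyl(T) := T − Sch(T) ∧ g. -/
def WeylT (g ginv : Ten2 n) (T : Ten4 n) : Ten4 n := fun α β μ ν =>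
  T α β μ ν - KN (SchT g ginv T) g α β μ ν

/-- Sch_u for Riemann-type tensors completely orthogonal to u. -/
def SchU (g ginv : Ten2 n) (ε : ℝ) (u : Vec n) (P : Ten4 n) : Ten2 n := fun β ν =>
  (1 / ((n : ℝ) - 3)) * (RicT ginv P β ν - ScalT ginv P / (2 * ((n : ℝ) - 2)) * gam g ε u β ν)

/-- Weyl_u for Riemann-type tensors completely orthogonal to u. -/
def WeylU (g ginv : Ten2 n) (ε : ℝ) (u : Vec n) (P : Ten4 n) : Ten4 n := fun α β μ ν =>
  P α β μ ν - KN (SchU g ginv ε u P) (gam g ε u) α β μ ν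

/-- Z_tr := tr_γ T^⊥. -/
def Ztr (ginv : Ten2 n) (ε : ℝ) (u : Vec n) (T : Ten4 n) : ℝ :=
  trGam ginv ε u (perp u T)

/-- γ-trace-free part of an orthogonal symmetric (0,2)-tensor. -/
def hat2 (g ginv : Ten2 n) (ε : ℝ) (u : Vec n) (S : Ten2 n) : Ten2 n := fun β ν =>
  S β ν - trGam ginv ε u S / ((n : ℝ) - 1) * gam g ε u β ν

/-- T̂^⊥ := T^⊥ − (Z_tr/(n−1)) γ. -/
def hatPerp (g ginv : Ten2 n) (ε : ℝ) (u : Vec n) (T : Ten4 n) : Ten2 n :=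
  hat2 g ginv ε u (perp u T)

/-- (V_tr)_μ := γ^{αβ} T^{⊥∥}_{αβμ}. -/
def Vtr (g ginv : Ten2 n) (ε : ℝ) (u : Vec n) (T : Ten4 n) : Vec n := fun μ =>
  ∑ α, ∑ β, gamUp ginv ε u α β * perppar g ε u T α β μ

/-- T̂^{⊥∥}_{αβμ} := T^{⊥∥}_{αβμ} + (1/(n−2))(−γ_{αβ}(V_tr)_μ + γ_{αμ}(V_tr)_β). -/
def hatPerppar (g ginv : Ten2 n) (ε : ℝ) (u : Vec n) (T : Ten4 n) : Ten3 n := fun α β μ =>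
  perppar g ε u T α β μ + (1 / ((n : ℝ) - 2)) *
    (- gam g ε u α β * Vtr g ginv ε u T μ + gam g ε u α μ * Vtr g ginv ε u T β)

/-- S^∥_{βν} := γ^ρ_β γ^κ_ν S_{ρκ}. -/
def s2par (g : Ten2 n) (ε : ℝ) (u : Vec n) (S : Ten2 n) : Ten2 n := fun β ν =>
  ∑ ρ, ∑ κ, gamMix g ε u ρ β * gamMix g ε u κ ν * S ρ κ

/-- S^{⊥∥}_β := γ^ρ_β u^κ S_{ρκ}. -/
def s2perppar (g : Ten2 n) (ε : ℝ) (u : Vec n) (S : Ten2 n) : Vec n := fun β =>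
  ∑ ρ, ∑ κ, gamMix g ε u ρ β * u κ * S ρ κ

/-- S^⊥ := u^ρ u^κ S_{ρκ}. -/
def s2perp (u : Vec n) (S : Ten2 n) : ℝ := ∑ ρ, ∑ κ, u ρ * u κ * S ρ κ

/-- σ^{(2)}_{βν} := σ_{βρ} σ^ρ{}_ν. -/
def sq (ginv : Ten2 n) (σ : Ten2 n) : Ten2 n := fun β ν =>
  ∑ ρ, ∑ κ, σ β ρ * ginv ρ κ * σ κ ν

/-- Mixed projector h^μ_{μ'} = γ^μ_{μ'} + ε y^μ y_{μ'} orthogonal to span{u,y}. -/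
def hMix (g : Ten2 n) (ε : ℝ) (u y : Vec n) : Ten2 n := fun μ μ' =>
  gamMix g ε u μ μ' + ε * y μ * lower g y μ'

/-- Covariant projector h_{αβ} = γ_{αβ} + ε y_α y_β. -/
def hCov (g : Ten2 n) (ε : ℝ) (u y : Vec n) : Ten2 n := fun α β =>
  gam g ε u α β + ε * lower g y α * lower g y β

/-- g is a symmetric nondegenerate bilinear form with (symmetric) inverse ginv. -/
def GoodMetric (g ginv : Ten2 n) : Prop :=
  (∀ α β, g α β = g β α) ∧ (∀ α β, ginv α β = ginv β α) ∧
    (∀ α β, (∑ μ, ginv α μ * g μ β) = if α = β then (1 : ℝ) else 0) ∧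
    (∀ α β, (∑ μ, g α μ * ginv μ β) = if α = β then (1 : ℝ) else 0)

/-- u is a unit vector with g(u,u) = ε ∈ {−1,1}. -/
def UnitVec (g : Ten2 n) (ε : ℝ) (u : Vec n) : Prop :=
  (ε = 1 ∨ ε = -1) ∧ (∑ α, ∑ β, g α β * u α * u β) = ε


/-- The full contraction `∑ A^{αβ} S_{αβ}`. -/
def contract2 (A S : Ten2 n) : ℝ := ∑ α, ∑ β, A α β * S α β

theorem sum_comm_pairs (f : Ten4 n) :
    ∑ α, ∑ β, ∑ μ, ∑ ν, f α β μ ν = ∑ μ, ∑ ν, ∑ α, ∑ β, f α β μ ν := by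
  simpa only [Fintype.sum_prod_type] using
    Finset.sum_comm (s := (Finset.univ : Finset (Fin n × Fin n)))
      (t := (Finset.univ : Finset (Fin n × Fin n))) (f := fun x y => f x.1 x.2 y.1 y.2)

theorem contract2_sum_sum (A : Ten2 n) (P Q : Ten2 n) (S : Ten2 n) :
    contract2 A (fun β ν => ∑ ρ, ∑ κ, P ρ β * Q κ ν * S ρ κ)
      = contract2 (fun ρ κ => ∑ β, P ρ β * ∑ ν, A β ν * Q κ ν) S := by
  unfold contract2
  simp only [Finset.mul_sum, Finset.sum_mul]
  rw [sum_comm_pairs]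
  exact Finset.sum_congr rfl fun _ _ => Finset.sum_congr rfl fun _ _ =>
    Finset.sum_congr rfl fun _ _ => Finset.sum_congr rfl fun _ _ => by ring

theorem sum_ginv_mul_lower {g ginv : Ten2 n} (hg : GoodMetric g ginv) (u : Vec n) (α : Fin n) :
    ∑ β, ginv α β * lower g u β = u α := by
  simp only [lower, Finset.mul_sum]
  rw [Finset.sum_comm]
  simp only [← mul_assoc, ← Finset.sum_mul, hg.2.2.1]
  simp

theorem sum_mul_lower {g : Ten2 n} {ε : ℝ} {u : Vec n} (hu : UnitVec g ε u) :
    ∑ β, u β * lower g u β = ε := by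
  rw [← hu.2]
  simp only [lower, Finset.mul_sum]
  exact Finset.sum_congr rfl fun _ _ => Finset.sum_congr rfl fun _ _ => by ring

theorem UnitVec.sq_eq_one {g : Ten2 n} {ε : ℝ} {u : Vec n} (hu : UnitVec g ε u) : ε * ε = 1 := by
  rcases hu.1 with h | h <;> simp [h]

/-- Contracting one index with the mixed projector. -/
theorem sum_mul_gamMix (g : Ten2 n) (ε : ℝ) (u w : Vec n) (κ : Fin n) :
    ∑ ν, w ν * gamMix g ε u κ ν = w κ - ε * u κ * ∑ ν, w ν * lower g u ν := by
  simp only [gamMix, mul_sub, Finset.sum_sub_distrib, Finset.mul_sum]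
  congr 1
  · simp
  · exact Finset.sum_congr rfl fun _ _ => by ring

theorem sum_gamMix_mul (g : Ten2 n) (ε : ℝ) (u w : Vec n) (ν : Fin n) :
    ∑ κ, gamMix g ε u κ ν * w κ = w ν - ε * lower g u ν * ∑ κ, u κ * w κ := by
  simp only [gamMix, sub_mul, Finset.sum_sub_distrib, Finset.mul_sum]
  congr 1
  · simp
  · exact Finset.sum_congr rfl fun _ _ => by ring

theorem sum_ginv_mul_gamMix {g ginv : Ten2 n} (hg : GoodMetric g ginv) (ε : ℝ) (u : Vec n)
    (α κ : Fin n) : ∑ ν, ginv α ν * gamMix g ε u κ ν = gamUp ginv ε u α κ := by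
  rw [sum_mul_gamMix, sum_ginv_mul_lower hg, gamUp]
  ring

theorem sum_gamUp_mul_gamMix {g ginv : Ten2 n} (hg : GoodMetric g ginv) {ε : ℝ} {u : Vec n}
    (hu : UnitVec g ε u) (α κ : Fin n) :
    ∑ ν, gamUp ginv ε u α ν * gamMix g ε u κ ν = gamUp ginv ε u α κ := by
  have h : ∑ ν, gamUp ginv ε u α ν * lower g u ν = 0 := by
    simp only [gamUp, sub_mul, Finset.sum_sub_distrib, mul_assoc, ← Finset.mul_sum]
    rw [sum_ginv_mul_lower hg, sum_mul_lower hu]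
    linear_combination -u α * hu.sq_eq_one
  rw [sum_mul_gamMix, h]
  ring

theorem gamUp_symm {g ginv : Ten2 n} (hg : GoodMetric g ginv) (ε : ℝ) (u : Vec n)
    (α β : Fin n) : gamUp ginv ε u α β = gamUp ginv ε u β α := by
  rw [gamUp, gamUp, hg.2.1 α β]
  ring

theorem sum_gamMix_mul_gamUp {g ginv : Ten2 n} (hg : GoodMetric g ginv) {ε : ℝ} {u : Vec n}
    (hu : UnitVec g ε u) (ρ κ : Fin n) :
    ∑ β, gamMix g ε u ρ β * gamUp ginv ε u β κ = gamUp ginv ε u ρ κ := by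
  rw [gamUp_symm hg, ← sum_gamUp_mul_gamMix hg hu κ ρ]
  exact Finset.sum_congr rfl fun β _ => by rw [gamUp_symm hg, mul_comm]

theorem contract2_ginv_s2par {g ginv : Ten2 n} (hg : GoodMetric g ginv) {ε : ℝ} {u : Vec n}
    (hu : UnitVec g ε u) (S : Ten2 n) :
    contract2 ginv (s2par g ε u S) = trGam ginv ε u S := by
  unfold s2par
  rw [contract2_sum_sum]
  simp only [sum_ginv_mul_gamMix hg, sum_gamMix_mul_gamUp hg hu]
  rfl

theorem trGam_s2par {g ginv : Ten2 n} (hg : GoodMetric g ginv) {ε : ℝ} {u : Vec n}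
    (hu : UnitVec g ε u) (S : Ten2 n) :
    trGam ginv ε u (s2par g ε u S) = trGam ginv ε u S := by
  change contract2 _ _ = _
  unfold s2par
  rw [contract2_sum_sum]
  simp only [sum_gamUp_mul_gamMix hg hu, sum_gamMix_mul_gamUp hg hu]
  rfl

theorem trGam_eq (ginv : Ten2 n) (ε : ℝ) (u : Vec n) (S : Ten2 n) :
    trGam ginv ε u S = contract2 ginv S - ε * s2perp u S := by
  simp only [trGam, contract2, s2perp, gamUp, sub_mul, Finset.sum_sub_distrib, Finset.mul_sum,
    mul_assoc]

theorem contract2_combo (A S S' : Ten2 n) (a b : ℝ) :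
    contract2 A (fun β ν => a * S β ν + b * S' β ν) = a * contract2 A S + b * contract2 A S' := by
  simp only [contract2, Finset.mul_sum, ← Finset.sum_add_distrib]
  exact Finset.sum_congr rfl fun _ _ => Finset.sum_congr rfl fun _ _ => by ring

theorem trGam_combo (ginv : Ten2 n) (ε : ℝ) (u : Vec n) (S S' : Ten2 n) (a b : ℝ) :
    trGam ginv ε u (fun β ν => a * S β ν + b * S' β ν)
      = a * trGam ginv ε u S + b * trGam ginv ε u S' :=
  contract2_combo _ _ _ _ _

theorem s2perp_combo (u : Vec n) (S S' : Ten2 n) (a b : ℝ) :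
    s2perp u (fun β ν => a * S β ν + b * S' β ν) = a * s2perp u S + b * s2perp u S' :=
  contract2_combo (fun ρ κ => u ρ * u κ) _ _ _ _

theorem s2par_combo (g : Ten2 n) (ε : ℝ) (u : Vec n) (S S' : Ten2 n) (a b : ℝ) :
    s2par g ε u (fun β ν => a * S β ν + b * S' β ν)
      = fun β ν => a * s2par g ε u S β ν + b * s2par g ε u S' β ν := by
  funext β ν
  exact contract2_combo (fun ρ κ => gamMix g ε u ρ β * gamMix g ε u κ ν) _ _ _ _

theorem s2perppar_combo (g : Ten2 n) (ε : ℝ) (u : Vec n) (S S' : Ten2 n) (a b : ℝ) (β : Fin n) :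
    s2perppar g ε u (fun β ν => a * S β ν + b * S' β ν) β
      = a * s2perppar g ε u S β + b * s2perppar g ε u S' β :=
  contract2_combo (fun ρ κ => gamMix g ε u ρ β * u κ) _ _ _ _

theorem s2par_eq (g : Ten2 n) (ε : ℝ) (u : Vec n) (S : Ten2 n) (β ν : Fin n) :
    s2par g ε u S β ν = ∑ ρ, gamMix g ε u ρ β * ∑ κ, gamMix g ε u κ ν * S ρ κ := by
  simp only [s2par, Finset.mul_sum, mul_assoc]

theorem s2perppar_eq (g : Ten2 n) (ε : ℝ) (u : Vec n) (S : Ten2 n) (β : Fin n) :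
    s2perppar g ε u S β = ∑ ρ, gamMix g ε u ρ β * ∑ κ, u κ * S ρ κ := by
  simp only [s2perppar, Finset.mul_sum, mul_assoc]

theorem s2par_of_orth {S : Ten2 n} {u : Vec n} (hS : Orth2 u S) (g : Ten2 n) (ε : ℝ) :
    s2par g ε u S = S := by
  funext β ν
  rw [s2par_eq]
  simp only [sum_gamMix_mul, hS.1, hS.2, mul_zero, sub_zero]

theorem s2par_metric {g ginv : Ten2 n} (hg : GoodMetric g ginv) {ε : ℝ} {u : Vec n}
    (hu : UnitVec g ε u) : s2par g ε u g = gam g ε u := by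
  have h : ∀ ν, ∑ κ, u κ * g κ ν = lower g u ν := fun ν =>
    Finset.sum_congr rfl fun κ _ => by rw [hg.1 κ ν, mul_comm]
  have h' : ∀ ν, ∑ κ, u κ * g ν κ = lower g u ν := fun ν =>
    Finset.sum_congr rfl fun κ _ => mul_comm _ _
  funext β ν
  rw [s2par_eq]
  simp only [sum_gamMix_mul, h', mul_sub, Finset.sum_sub_distrib, h]
  simp only [mul_left_comm (u _), ← Finset.mul_sum, sum_mul_lower hu, gam]
  linear_combination ε * lower g u β * lower g u ν * hu.sq_eq_one

theorem s2perp_metric {g : Ten2 n} {ε : ℝ} {u : Vec n} (hu : UnitVec g ε u) :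
    s2perp u g = ε := by
  rw [← hu.2]
  exact Finset.sum_congr rfl fun _ _ => Finset.sum_congr rfl fun _ _ => by ring

theorem s2perppar_metric {g : Ten2 n} {ε : ℝ} {u : Vec n} (hu : UnitVec g ε u) (β : Fin n) :
    s2perppar g ε u g β = 0 := by
  have h : ∀ ν, ∑ κ, u κ * g ν κ = lower g u ν := fun ν =>
    Finset.sum_congr rfl fun κ _ => mul_comm _ _
  simp only [s2perppar_eq, h, sum_gamMix_mul, sum_mul_lower hu]
  linear_combination -lower g u β * hu.sq_eq_one

theorem trGam_metric {g ginv : Ten2 n} (hg : GoodMetric g ginv) {ε : ℝ} {u : Vec n}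
    (hu : UnitVec g ε u) : trGam ginv ε u g = n - 1 := by
  have h : contract2 ginv g = n := by
    have h' : ∀ α, ∑ β, ginv α β * g α β = 1 := fun α => by
      simpa [hg.1 α] using hg.2.2.1 α α
    simp [contract2, h']
  rw [trGam_eq, s2perp_metric hu, h, hu.sq_eq_one]

theorem par4_eq (g : Ten2 n) (ε : ℝ) (u : Vec n) (T : Ten4 n) (α β μ ν : Fin n) :
    par4 g ε u T α β μ ν
      = s2par g ε u (fun ρ κ => s2par g ε u (fun σ δ => T ρ σ κ δ) β ν) α μ := by
  simp only [par4, s2par, Finset.mul_sum]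
  refine Finset.sum_congr rfl fun ρ _ => ?_
  rw [Finset.sum_comm]
  refine Finset.sum_congr rfl fun κ _ => Finset.sum_congr rfl fun σ _ =>
    Finset.sum_congr rfl fun δ _ => by ring

/-- Contractions over disjoint pairs of indices commute. -/
theorem contract2_comm (A B : Ten2 n) (T : Ten4 n) :
    contract2 A (fun ρ κ => contract2 B (fun σ δ => T ρ σ κ δ))
      = contract2 B (fun σ δ => contract2 A (fun ρ κ => T ρ σ κ δ)) := by
  simp only [contract2, Finset.mul_sum]
  rw [sum_comm_pairs]
  exact Finset.sum_congr rfl fun _ _ => Finset.sum_congr rfl fun _ _ =>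
    Finset.sum_congr rfl fun _ _ => Finset.sum_congr rfl fun _ _ => by ring

theorem perp_orth {T : Ten4 n} (hT : IsRiemannType T) (u : Vec n) : Orth2 u (perp u T) := by
  have h : ∀ ν, ∑ β, u β * perp u T β ν = 0 := fun ν => by
    have : ∑ β, u β * perp u T β ν = -∑ β, u β * perp u T β ν := by
      conv_lhs => simp only [perp, Finset.mul_sum]
      conv_rhs => simp only [perp, Finset.mul_sum, ← Finset.sum_neg_distrib]
      rw [Finset.sum_comm]
      exact Finset.sum_congr rfl fun α _ => Finset.sum_congr rfl fun β _ =>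
        Finset.sum_congr rfl fun μ _ => by rw [hT.2.1]; ring
    linarith
  have hs : ∀ β ν, perp u T β ν = perp u T ν β := fun β ν => by
    unfold perp
    rw [Finset.sum_comm]
    exact Finset.sum_congr rfl fun α _ => Finset.sum_congr rfl fun μ _ => by
      rw [hT.2.2.1]; ring
  exact ⟨h, fun β => by simpa only [hs β] using h β⟩

theorem RicT_symm {g ginv : Ten2 n} (hg : GoodMetric g ginv) {T : Ten4 n} (hT : IsRiemannType T)
    (β ν : Fin n) : RicT ginv T β ν = RicT ginv T ν β := by
  unfold RicT
  rw [Finset.sum_comm]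
  exact Finset.sum_congr rfl fun α _ => Finset.sum_congr rfl fun μ _ => by
    rw [hT.2.2.1, hg.2.1]

theorem trGam_slots (ginv : Ten2 n) (ε : ℝ) (u : Vec n) (T : Ten4 n) (σ δ : Fin n) :
    trGam ginv ε u (fun ρ κ => T ρ σ κ δ) = 1 * RicT ginv T σ δ + -ε * perp u T σ δ := by
  rw [trGam_eq]
  simp only [contract2, s2perp, RicT, perp]
  ring

theorem RicT_par4 {g ginv : Ten2 n} (hg : GoodMetric g ginv) {ε : ℝ} {u : Vec n}
    (hu : UnitVec g ε u) {T : Ten4 n} (hT : IsRiemannType T) :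
    RicT ginv (par4 g ε u T)
      = fun β ν => 1 * s2par g ε u (RicT ginv T) β ν + -ε * perp u T β ν := by
  funext β ν
  have h := contract2_ginv_s2par hg hu
    (fun ρ κ => s2par g ε u (fun σ δ => T ρ σ κ δ) β ν)
  simp only [RicT, par4_eq]
  refine h.trans ((contract2_comm (gamUp ginv ε u)
    (fun σ δ => gamMix g ε u σ β * gamMix g ε u δ ν) T).trans ?_)
  change s2par g ε u (fun σ δ => trGam ginv ε u (fun ρ κ => T ρ σ κ δ)) β ν = _
  simp only [trGam_slots, s2par_combo, s2par_of_orth (perp_orth hT u)]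

theorem s2perp_of_orth {S : Ten2 n} {u : Vec n} (hS : Orth2 u S) : s2perp u S = 0 := by
  simp only [s2perp, mul_assoc, ← Finset.mul_sum, hS.2, mul_zero, Finset.sum_const_zero]

theorem s2perp_RicT (ginv : Ten2 n) (ε : ℝ) {u : Vec n} {T : Ten4 n} (hT : IsRiemannType T) :
    s2perp u (RicT ginv T) = Ztr ginv ε u T := by
  rw [Ztr, trGam_eq, s2perp_of_orth (perp_orth hT u), mul_zero, sub_zero]
  refine (contract2_comm (fun ρ κ => u ρ * u κ) ginv fun ρ σ κ δ => T σ ρ δ κ).trans ?_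
  refine Finset.sum_congr rfl fun σ _ => Finset.sum_congr rfl fun δ _ => ?_
  congr 1
  exact Finset.sum_congr rfl fun ρ _ => Finset.sum_congr rfl fun κ _ => by
    rw [hT.1, hT.2.1, neg_neg]

theorem ScalT_par4 {g ginv : Ten2 n} (hg : GoodMetric g ginv) {ε : ℝ} {u : Vec n}
    (hu : UnitVec g ε u) {T : Ten4 n} (hT : IsRiemannType T) :
    ScalT ginv (par4 g ε u T) = ScalT ginv T - 2 * ε * Ztr ginv ε u T := by
  have hZ : contract2 ginv (perp u T) = Ztr ginv ε u T := by
    rw [Ztr, trGam_eq, s2perp_of_orth (perp_orth hT u), mul_zero, sub_zero]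
  change contract2 ginv (RicT ginv (par4 g ε u T)) = contract2 ginv (RicT ginv T) - _
  rw [RicT_par4 hg hu hT, contract2_combo, contract2_ginv_s2par hg hu, trGam_eq, hZ,
    s2perp_RicT ginv ε hT]
  ring

theorem Vtr_eq {g ginv : Ten2 n} (hg : GoodMetric g ginv) {ε : ℝ} {u : Vec n}
    (hu : UnitVec g ε u) {T : Ten4 n} (hT : IsRiemannType T) (μ : Fin n) :
    Vtr g ginv ε u T μ = -s2perppar g ε u (RicT ginv T) μ := by
  have h1 : ∀ α, ∑ β, gamUp ginv ε u α β * perppar g ε u T α β μ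
      = ∑ κ, gamUp ginv ε u α κ * ∑ σ, ∑ ρ, gamMix g ε u σ μ * u ρ * T ρ α κ σ := fun α => by
    have h : ∀ κ, gamUp ginv ε u α κ = ∑ β, gamUp ginv ε u α β * gamMix g ε u κ β :=
      fun κ => (sum_gamUp_mul_gamMix hg hu α κ).symm
    conv_rhs => enter [2, κ]; rw [h κ, Finset.sum_mul]
    rw [Finset.sum_comm]
    refine Finset.sum_congr rfl fun β _ => ?_
    simp only [perppar, Finset.mul_sum]
    rw [Finset.sum_comm]
    refine Finset.sum_congr rfl fun κ _ => ?_
    rw [Finset.sum_comm]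
    exact Finset.sum_congr rfl fun _ _ => Finset.sum_congr rfl fun _ _ => by ring
  simp only [Vtr, h1]
  refine (contract2_comm (gamUp ginv ε u) (fun σ ρ => gamMix g ε u σ μ * u ρ)
    fun α σ κ ρ => T ρ α κ σ).trans ?_
  have h2 : ∀ σ ρ, contract2 (gamUp ginv ε u) (fun α κ => T ρ α κ σ)
      = -1 * RicT ginv T σ ρ + ε * perp u T ρ σ := fun σ ρ => by
    have h3 := trGam_slots ginv ε u T ρ σ
    have h4 : contract2 (gamUp ginv ε u) (fun α κ => T ρ α κ σ)
        = -trGam ginv ε u (fun α κ => T α ρ κ σ) := by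
      simp only [contract2, trGam, ← Finset.sum_neg_distrib]
      exact Finset.sum_congr rfl fun α _ => Finset.sum_congr rfl fun κ _ => by
        rw [hT.2.1 ρ, mul_neg]
    rw [h4, h3, RicT_symm hg hT σ ρ]
    ring
  simp only [h2]
  rw [contract2_combo]
  have h5 : contract2 (fun σ ρ => gamMix g ε u σ μ * u ρ) (fun σ ρ => perp u T ρ σ) = 0 := by
    simp only [contract2, mul_assoc, ← Finset.mul_sum, (perp_orth hT u).1, mul_zero,
      Finset.sum_const_zero]
  rw [h5, mul_zero, add_zero, neg_one_mul]
  rfl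

theorem SchT_eq (g ginv : Ten2 n) (T : Ten4 n) :
    SchT g ginv T = fun β ν => 1 / ((n : ℝ) - 2) * RicT ginv T β ν
      + -(1 / ((n : ℝ) - 2) * (ScalT ginv T / (2 * ((n : ℝ) - 1)))) * g β ν := by
  funext β ν
  rw [SchT]
  ring

/-- identities (r1)-(r4) for a general Riemann-type tensor: components of
`Sch(T)` with respect to `u`. -/
theorem stmt8 {n : ℕ} (hn : 4 ≤ n) (g ginv : Ten2 n) (hg : GoodMetric g ginv)
    (ε : ℝ) (u : Vec n) (hu : UnitVec g ε u)
    (T : Ten4 n) (hT : IsRiemannType T) :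
    trGam ginv ε u (s2par g ε u (SchT g ginv T))
        = ScalT ginv (par4 g ε u T) / (2 * ((n : ℝ) - 2)) ∧
    s2perp u (SchT g ginv T)
        = (1 / ((n : ℝ) - 1)) *
            (Ztr ginv ε u T - ε * ScalT ginv (par4 g ε u T) / (2 * ((n : ℝ) - 2))) ∧
    (∀ β ν, hat2 g ginv ε u (s2par g ε u (SchT g ginv T)) β ν =
        (1 / ((n : ℝ) - 2)) * (ε * hatPerp g ginv ε u T β ν
          + hat2 g ginv ε u (RicT ginv (par4 g ε u T)) β ν)) ∧
    (∀ β, s2perppar g ε u (SchT g ginv T) β = -(1 / ((n : ℝ) - 2)) * Vtr g ginv ε u T β) := by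
  have hn' : (4 : ℝ) ≤ n := by exact_mod_cast hn
  have h1 : (n : ℝ) - 1 ≠ 0 := by linarith
  have h2 : (n : ℝ) - 2 ≠ 0 := by linarith
  have hε := hu.sq_eq_one
  have hR : trGam ginv ε u (RicT ginv T) = ScalT ginv T - ε * Ztr ginv ε u T := by
    rw [trGam_eq, s2perp_RicT ginv ε hT]
    rfl
  have hgam : trGam ginv ε u (gam g ε u) = n - 1 := by
    rw [← s2par_metric hg hu, trGam_s2par hg hu, trGam_metric hg hu]
  refine ⟨?_, ?_, fun β ν => ?_, fun β => ?_⟩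
  · rw [trGam_s2par hg hu, SchT_eq, trGam_combo, hR, trGam_metric hg hu, ScalT_par4 hg hu hT]
    field_simp
    ring
  · rw [SchT_eq, s2perp_combo, s2perp_RicT ginv ε hT, s2perp_metric hu, ScalT_par4 hg hu hT]
    field_simp
    linear_combination (-2 * Ztr ginv ε u T) * hε
  · simp only [hatPerp, hat2]
    rw [SchT_eq, s2par_combo, trGam_combo, RicT_par4 hg hu hT, trGam_combo, s2par_metric hg hu,
      hgam]
    field_simp
    ring
  · rw [SchT_eq, s2perppar_combo, s2perppar_metric hu, Vtr_eq hg hu hT]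
    ring

end Decomp
end
end

section
/- The following trace-removal identity holds: σ ∧ σ − Sch_u(σ ∧ σ) ∧ γ = σ ∧ σ + (2/(n−3)) σ^{(2)} ∧ γ − (tr_γ σ^{(2)} / ((n−2)(n−3))) γ ∧ γ. -/
open scoped BigOperators

noncomputable section

namespace Decomp

variable {n : ℕ}

/-- For a tensor annihilated by `u` in its first slot, `tr_γ` agrees with the metric trace. -/
theorem trGam_eq_of_left {n : ℕ} {ginv : Ten2 n} {ε : ℝ} {u : Vec n} {S : Ten2 n}
    (hS : ∀ β, (∑ α, u α * S α β) = 0) :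
    trGam ginv ε u S = ∑ α, ∑ β, ginv α β * S α β := by
  have h : ∑ α, ∑ β, ε * u α * u β * S α β = 0 := by
    rw [Finset.sum_comm]
    refine Finset.sum_eq_zero fun β _ => ?_
    calc ∑ α, ε * u α * u β * S α β = ε * u β * ∑ α, u α * S α β := by
          rw [Finset.mul_sum]
          exact Finset.sum_congr rfl fun _ _ => by ring
      _ = 0 := by rw [hS, mul_zero]
  simp only [trGam, gamUp, sub_mul, Finset.sum_sub_distrib, h, sub_zero]

theorem sq_left_orth {n : ℕ} {ginv : Ten2 n} {u : Vec n} {σ : Ten2 n} (hσ : Orth2 u σ) (ν : Fin n) :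
    (∑ β, u β * sq ginv σ β ν) = 0 := by
  simp only [sq, Finset.mul_sum]
  rw [Finset.sum_comm]
  refine Finset.sum_eq_zero fun ρ _ => ?_
  rw [Finset.sum_comm]
  refine Finset.sum_eq_zero fun κ _ => ?_
  calc ∑ β, u β * (σ β ρ * ginv ρ κ * σ κ ν) = (∑ β, u β * σ β ρ) * (ginv ρ κ * σ κ ν) := by
        rw [Finset.sum_mul]
        exact Finset.sum_congr rfl fun _ _ => by ring
    _ = 0 := by rw [hσ.1, zero_mul]

/-- The Ricci trace of `σ ∧ σ` is `2 (tr σ) σ - 2 σ²`. -/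
theorem RicT_KN_self {n : ℕ} {g ginv : Ten2 n} (hg : GoodMetric g ginv) (σ : Ten2 n)
    (β ν : Fin n) :
    RicT ginv (KN σ σ) β ν =
      2 * (∑ α, ∑ μ, ginv α μ * σ α μ) * σ β ν - 2 * sq ginv σ β ν := by
  have hsq : sq ginv σ β ν = ∑ α, ∑ μ, ginv α μ * (σ α ν * σ β μ) := by
    rw [sq, Finset.sum_comm]
    exact Finset.sum_congr rfl fun α _ => Finset.sum_congr rfl fun μ _ => by
      rw [hg.2.1 α μ]; ring
  rw [hsq]
  simp only [RicT, KN, Finset.mul_sum, Finset.sum_mul, ← Finset.sum_sub_distrib]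
  exact Finset.sum_congr rfl fun _ _ => Finset.sum_congr rfl fun _ _ => by ring

/-- the trace-removal identity
`σ∧σ − Sch_u(σ∧σ)∧γ = σ∧σ + (2/(n−3)) σ^{(2)}∧γ − (tr_γ σ^{(2)}/((n−2)(n−3))) γ∧γ`. -/
theorem stmt13 {n : ℕ} (hn : 4 ≤ n) (g ginv : Ten2 n) (hg : GoodMetric g ginv)
    (ε : ℝ) (u : Vec n) (hu : UnitVec g ε u)
    (σ : Ten2 n) (hσ : IsSym2 σ) (hσo : Orth2 u σ) (hσtr : trGam ginv ε u σ = 0) :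
    ∀ α β μ ν,
      KN σ σ α β μ ν - KN (SchU g ginv ε u (KN σ σ)) (gam g ε u) α β μ ν =
        KN σ σ α β μ ν + (2 / ((n : ℝ) - 3)) * KN (sq ginv σ) (gam g ε u) α β μ ν
          - (trGam ginv ε u (sq ginv σ) / (((n : ℝ) - 2) * ((n : ℝ) - 3))) *
              KN (gam g ε u) (gam g ε u) α β μ ν := by
  have h1 : RicT ginv (KN σ σ) = fun β ν => -2 * sq ginv σ β ν := by
    funext β ν
    rw [RicT_KN_self hg, ← trGam_eq_of_left hσo.1, hσtr]
    ring
  have h2 : ScalT ginv (KN σ σ) = -2 * trGam ginv ε u (sq ginv σ) := by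
    rw [trGam_eq_of_left (sq_left_orth hσo), ScalT, h1]
    simp only [Finset.mul_sum]
    exact Finset.sum_congr rfl fun _ _ => Finset.sum_congr rfl fun _ _ => by ring
  have hn' : (4 : ℝ) ≤ n := by exact_mod_cast hn
  have h3 : (n : ℝ) - 3 ≠ 0 := by linarith
  have h4 : (n : ℝ) - 2 ≠ 0 := by linarith
  intro α β μ ν
  unfold SchU
  simp only [h1, h2, KN]
  field_simp
  ring

end Decomp
end
end

section
/- If n = 4 and W ∈ W(V), then the fully tangential projection of W is determined by its u-u component: W^∥ = −ε W^⊥ ∧ γ. -/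
open scoped BigOperators

noncomputable section

namespace Decomp

variable {n : ℕ}

/-- A real bilinear form that is non-null on `x` has an orthogonal basis starting with `x`. -/
theorem exists_orthogonal_basis_zero_eq {V : Type*} [AddCommGroup V] [Module ℝ V]
    [FiniteDimensional ℝ V] {m : ℕ} (hV : Module.finrank ℝ V = m + 1)
    {B : LinearMap.BilinForm ℝ V} (hB : B.IsSymm) {x : V} (hx : B x x ≠ 0) :
    ∃ b : Module.Basis (Fin (m + 1)) ℝ V, b 0 = x ∧ B.IsOrthoᵢ b := by
  have hx0 : x ≠ 0 := fun h => hx (by simp [h])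
  have hc := LinearMap.BilinForm.isCompl_span_singleton_orthogonal hx
  have hdim := Submodule.finrank_add_eq_of_isCompl hc
  rw [finrank_span_singleton hx0, hV] at hdim
  obtain rfl : Module.finrank ℝ (B.orthogonal (Submodule.span ℝ {x})) = m := by omega
  obtain ⟨v, hv⟩ := LinearMap.BilinForm.exists_orthogonal_basis
    (B := B.restrict (B.orthogonal (Submodule.span ℝ {x})))
    ⟨fun y z => hB.eq (y : V) (z : V)⟩
  have hmem : ∀ i, B x (v i) = 0 := fun i =>
    (v i).prop _ (Submodule.mem_span_singleton_self x)
  refine ⟨Module.Basis.mkFinCons x v ?_ ?_, by rw [Module.Basis.coe_mkFinCons, Fin.cons_zero], ?_⟩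
  · intro c y hy hcy
    have hxy : B x y = 0 := hy _ (Submodule.mem_span_singleton_self x)
    have := congrArg (B x) hcy
    simpa [hxy, hx] using this
  · intro y
    refine ⟨-B x y / B x x, fun z hz => ?_⟩
    obtain ⟨c, rfl⟩ := Submodule.mem_span_singleton.1 hz
    simp [hx]
  · rw [Module.Basis.coe_mkFinCons]
    intro i j
    refine Fin.cases ?_ (fun i => ?_) i <;> refine Fin.cases ?_ (fun j => ?_) j <;> intro hij
    · exact (hij rfl).elim
    · simpa [Function.onFun] using hmem j
    · simpa [Function.onFun, hB.eq x] using (hB.eq x (v i)).symm.trans (hmem i)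
    · exact hv (ne_of_apply_ne _ hij)

/-- The bilinear form with the given components. -/
def metricForm (g : Ten2 n) : LinearMap.BilinForm ℝ (Vec n) :=
  Matrix.toLinearMap₂' ℝ (Matrix.of g)

theorem metricForm_apply (g : Ten2 n) (x y : Vec n) :
    metricForm g x y = ∑ α, ∑ β, x α * y β * g α β := by
  rw [metricForm, Matrix.toLinearMap₂'_apply]
  refine Finset.sum_congr rfl fun i _ => Finset.sum_congr rfl fun j _ => ?_
  simp only [smul_eq_mul, Matrix.of_apply]
  ring

/-- The inverse of a metric is diagonal in any basis orthogonal for the metric. -/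
theorem ginv_eq_sum_of_orthogonal {g ginv : Ten2 n}
    (hg : ∀ α β, (∑ μ, g α μ * ginv μ β) = if α = β then (1 : ℝ) else 0)
    {b : Fin n → Vec n} {d : Fin n → ℝ} (hd : ∀ i, d i ≠ 0)
    (hb : ∀ i j, metricForm g (b i) (b j) = if i = j then d i else 0)
    (α μ : Fin n) : ginv α μ = ∑ i, (d i)⁻¹ * b i α * b i μ := by
  set M : Matrix (Fin n) (Fin n) ℝ := Matrix.of b
  set G : Matrix (Fin n) (Fin n) ℝ := Matrix.of g
  have h1 : M * G * M.transpose = Matrix.diagonal d := by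
    ext i j
    have := hb i j
    rw [metricForm, Matrix.toLinearMap₂'_apply'] at this
    rw [Matrix.diagonal_apply, ← this, Matrix.mul_assoc, Matrix.mul_apply]
    rfl
  have h2 : (Matrix.diagonal (fun i => (d i)⁻¹) * M * G) * M.transpose = 1 := by
    rw [Matrix.mul_assoc, Matrix.mul_assoc, ← Matrix.mul_assoc M, h1, Matrix.diagonal_mul_diagonal]
    simp [hd]
  have h3 : (M.transpose * Matrix.diagonal (fun i => (d i)⁻¹) * M) * G = 1 := by
    rw [mul_eq_one_comm] at h2
    simpa only [Matrix.mul_assoc] using h2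
  have h4 : G * Matrix.of ginv = 1 := by
    ext i j
    rw [Matrix.mul_apply, Matrix.one_apply]
    exact hg i j
  have h5 := left_inv_eq_right_inv h3 h4
  have h6 := congrFun (congrFun h5 α) μ
  rw [Matrix.of_apply] at h6
  rw [← h6, Matrix.mul_apply]
  refine Finset.sum_congr rfl fun i _ => ?_
  rw [Matrix.mul_diagonal, Matrix.transpose_apply, mul_comm (M i α)]
  rfl

/-- The quadrilinear form with the given components. -/
def quadForm (T : Ten4 n) : Vec n →ₗ[ℝ] Vec n →ₗ[ℝ] Vec n →ₗ[ℝ] Vec n →ₗ[ℝ] ℝ :=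
  ∑ α, ∑ β, ∑ μ, ∑ ν, (LinearMap.proj α).smulRight ((LinearMap.proj β).smulRight
    ((LinearMap.proj μ).smulRight (T α β μ ν • LinearMap.proj ν)))

theorem quadForm_apply (T : Ten4 n) (x y z w : Vec n) :
    quadForm T x y z w = ∑ α, ∑ β, ∑ μ, ∑ ν, x α * y β * z μ * w ν * T α β μ ν := by
  simp only [quadForm, LinearMap.sum_apply, LinearMap.smulRight_apply, LinearMap.smul_apply,
    LinearMap.proj_apply, smul_eq_mul]
  refine Finset.sum_congr rfl fun α _ => Finset.sum_congr rfl fun β _ =>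
    Finset.sum_congr rfl fun μ _ => Finset.sum_congr rfl fun ν _ => by ring

theorem quadForm_swap_left {T : Ten4 n} (hT : ∀ α β μ ν, T α β μ ν = - T β α μ ν)
    (x y z w : Vec n) : quadForm T x y z w = - quadForm T y x z w := by
  rw [quadForm_apply, quadForm_apply, Finset.sum_comm]
  simp only [← Finset.sum_neg_distrib]
  refine Finset.sum_congr rfl fun α _ => Finset.sum_congr rfl fun β _ =>
    Finset.sum_congr rfl fun μ _ => Finset.sum_congr rfl fun ν _ => ?_
  rw [hT]
  ring

theorem quadForm_swap_right {T : Ten4 n} (hT : ∀ α β μ ν, T α β μ ν = - T α β ν μ)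
    (x y z w : Vec n) : quadForm T x y z w = - quadForm T x y w z := by
  rw [quadForm_apply, quadForm_apply]
  simp only [← Finset.sum_neg_distrib]
  refine Finset.sum_congr rfl fun α _ => Finset.sum_congr rfl fun β _ => ?_
  rw [Finset.sum_comm]
  refine Finset.sum_congr rfl fun μ _ => Finset.sum_congr rfl fun ν _ => ?_
  rw [hT]
  ring

theorem quadForm_single_second_fourth (T : Ten4 n) (x z : Vec n) (β ν : Fin n) :
    quadForm T x (Pi.single β 1) z (Pi.single ν 1) = ∑ α, ∑ μ, x α * z μ * T α β μ ν := by
  simp [quadForm_apply, Pi.single_apply]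

/-- The trace over the first and third slots, computed in an orthogonal basis. -/
theorem sum_quadForm_eq_zero {ginv : Ten2 n} {T : Ten4 n} (hT : ∀ β ν, RicT ginv T β ν = 0)
    {b : Fin n → Vec n} {t : Fin n → ℝ}
    (hb : ∀ α μ, ginv α μ = ∑ i, t i * b i α * b i μ) (y w : Vec n) :
    ∑ i, t i * quadForm T (b i) y (b i) w = 0 := by
  set S : Vec n →ₗ[ℝ] Vec n →ₗ[ℝ] ℝ := ∑ i, t i • (quadForm T (b i)).flip (b i) with hS
  have key : S = 0 := by
    refine (Pi.basisFun ℝ (Fin n)).ext fun β => (Pi.basisFun ℝ (Fin n)).ext fun ν => ?_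
    rw [LinearMap.zero_apply, LinearMap.zero_apply, ← hT β ν]
    simp only [hS, LinearMap.sum_apply, LinearMap.smul_apply, LinearMap.flip_apply,
      Pi.basisFun_apply, quadForm_single_second_fourth, smul_eq_mul, RicT, hb, Finset.mul_sum,
      Finset.sum_mul]
    rw [Finset.sum_comm]
    refine Finset.sum_congr rfl fun α _ => ?_
    rw [Finset.sum_comm]
    refine Finset.sum_congr rfl fun μ _ => Finset.sum_congr rfl fun i _ => by ring
  have := congrArg (fun f => f y w) key
  simpa [hS] using this

theorem eq_zero_of_isLinearMap_of_basis {ι V : Type*} [AddCommGroup V] [Module ℝ V]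
    (b : Module.Basis ι ℝ V) {f : V → ℝ} (hf : IsLinearMap ℝ f) (h : ∀ i, f (b i) = 0) (x : V) :
    f x = 0 := by
  have : hf.mk' f = 0 := b.ext h
  exact congrArg (fun φ => φ x) this

/-- In dimension three a tensor antisymmetric in both pairs whose trace vanishes is zero. -/
theorem eq_zero_of_trace_eq_zero {Q : Ten4 3} {t : Vec 3} (ht : ∀ i, t i ≠ 0)
    (h12 : ∀ a b c e, Q a b c e = - Q b a c e) (h34 : ∀ a b c e, Q a b c e = - Q a b e c)
    (htr : ∀ b e, ∑ i, t i * Q i b i e = 0) (a b c e : Fin 3) : Q a b c e = 0 := by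
  have hl : ∀ a c e, Q a a c e = 0 := fun a c e => by linarith [h12 a a c e]
  have hr : ∀ a b c, Q a b c c = 0 := fun a b c => by linarith [h34 a b c c]
  simp only [Fin.sum_univ_three] at htr
  have t0 := ht 0
  have t1 := ht 1
  have t2 := ht 2
  have e1 : Q 0 1 0 1 = 0 := by
    have h := htr 0 0
    have h' := htr 1 1
    have h'' := htr 2 2
    rw [h12 1 0, h34 0 1, h12 2 0, h34 0 2, hl] at h
    rw [h12 2 1, h34 1 2, hl] at h'
    rw [hl] at h''
    have : t 0 * t 1 * Q 0 1 0 1 = 0 := by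
      linear_combination (t 0 * h + t 1 * h' - t 2 * h'') / 2
    simpa [t0, t1] using this
  have e2 : Q 0 2 0 2 = 0 := by
    have h := htr 0 0
    rw [h12 1 0, h34 0 1, h12 2 0, h34 0 2, hl, e1] at h
    simpa [t2] using h
  have e3 : Q 1 2 1 2 = 0 := by
    have h := htr 2 2
    rw [hl, e2] at h
    simpa [t1] using h
  have e4 : Q 0 1 0 2 = 0 := by simpa [hl, hr, t0] using htr 1 2
  have e5 : Q 0 2 0 1 = 0 := by simpa [hl, hr, t0] using htr 2 1
  have e6 : Q 1 0 1 2 = 0 := by simpa [hl, hr, t1] using htr 0 2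
  have e7 : Q 1 2 1 0 = 0 := by simpa [hl, hr, t1] using htr 2 0
  have e8 : Q 2 0 2 1 = 0 := by simpa [hl, hr, t2] using htr 0 1
  have e9 : Q 2 1 2 0 = 0 := by simpa [hl, hr, t2] using htr 1 0
  fin_cases a <;> fin_cases b <;> fin_cases c <;> fin_cases e <;>
    first
    | exact hl _ _ _
    | exact hr _ _ _
    | (dsimp only [Fin.zero_eta, Fin.mk_one, Fin.reduceFinMk]; grind)

/-- The orthogonal projection `x ↦ x - ε g(u, x) u`. -/
def orthProj (B : LinearMap.BilinForm ℝ (Vec n)) (ε : ℝ) (u : Vec n) : Vec n →ₗ[ℝ] Vec n :=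
  LinearMap.id - ε • (B u).smulRight u

theorem orthProj_apply (B : LinearMap.BilinForm ℝ (Vec n)) (ε : ℝ) (u x : Vec n) :
    orthProj B ε u x = x - (ε * B u x) • u := by
  simp [orthProj, smul_smul]

theorem metricForm_single_right {g : Ten2 n} (hg : ∀ α β, g α β = g β α) (u : Vec n)
    (α : Fin n) :
    metricForm g u (Pi.single α 1) = lower g u α := by
  simp [metricForm_apply, Pi.single_apply, lower, hg α, mul_comm]

theorem lower_single {g : Ten2 n} (hg : ∀ α β, g α β = g β α) (α β : Fin n) :
    lower g (Pi.single α 1) β = g α β := by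
  simp [lower, Pi.single_apply, hg α]

theorem par4_eq_quadForm {g : Ten2 n} (hg : ∀ α β, g α β = g β α) (ε : ℝ) (u : Vec n)
    (T : Ten4 n) (α β μ ν : Fin n) :
    par4 g ε u T α β μ ν =
      quadForm T (orthProj (metricForm g) ε u (Pi.single α 1))
        (orthProj (metricForm g) ε u (Pi.single β 1))
        (orthProj (metricForm g) ε u (Pi.single μ 1))
        (orthProj (metricForm g) ε u (Pi.single ν 1)) := by
  have h : ∀ κ μ, orthProj (metricForm g) ε u (Pi.single μ 1) κ =
      gamMix g ε u κ μ := by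
    intro κ μ
    rw [orthProj_apply, metricForm_single_right hg]
    simp [gamMix, Pi.single_apply]
    ring
  simp only [par4, quadForm_apply, h]

theorem perp_eq_quadForm (u : Vec n) (T : Ten4 n) (β ν : Fin n) :
    perp u T β ν = quadForm T u (Pi.single β 1) u (Pi.single ν 1) :=
  (quadForm_single_second_fourth T u u β ν).symm

/-- The multilinear extension to vectors of `T^∥ + ε T^⊥ ∧ γ`. -/
def tangentialDefect (T : Ten4 n) (B : LinearMap.BilinForm ℝ (Vec n)) (ε : ℝ) (u x y z w : Vec n) :
    ℝ :=
  quadForm T (orthProj B ε u x) (orthProj B ε u y) (orthProj B ε u z) (orthProj B ε u w) +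
    ε * (quadForm T u x u z * (B y w - ε * B u y * B u w)
      - quadForm T u x u w * (B y z - ε * B u y * B u z)
      - quadForm T u y u z * (B x w - ε * B u x * B u w)
      + quadForm T u y u w * (B x z - ε * B u x * B u z))

section Linear

variable (T : Ten4 n) (B : LinearMap.BilinForm ℝ (Vec n)) (ε : ℝ) (u : Vec n)

theorem isLinearMap_tangentialDefect_first (y z w : Vec n) :
    IsLinearMap ℝ fun x => tangentialDefect T B ε u x y z w := by
  constructor <;> intros <;>
    simp only [tangentialDefect, map_add, map_smul, LinearMap.add_apply, LinearMap.smul_apply,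
      smul_eq_mul] <;> ring

theorem isLinearMap_tangentialDefect_second (x z w : Vec n) :
    IsLinearMap ℝ fun y => tangentialDefect T B ε u x y z w := by
  constructor <;> intros <;>
    simp only [tangentialDefect, map_add, map_smul, LinearMap.add_apply, LinearMap.smul_apply,
      smul_eq_mul] <;> ring

theorem isLinearMap_tangentialDefect_third (x y w : Vec n) :
    IsLinearMap ℝ fun z => tangentialDefect T B ε u x y z w := by
  constructor <;> intros <;>
    simp only [tangentialDefect, map_add, map_smul, LinearMap.add_apply, LinearMap.smul_apply,
      smul_eq_mul] <;> ring

theorem isLinearMap_tangentialDefect_fourth (x y z : Vec n) :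
    IsLinearMap ℝ fun w => tangentialDefect T B ε u x y z w := by
  constructor <;> intros <;>
    simp only [tangentialDefect, map_add, map_smul, smul_eq_mul] <;> ring

end Linear

/-- In dimension four, `W^∥ + ε W^⊥ ∧ γ` vanishes for a Weyl-type tensor `W`. -/
theorem tangentialDefect_eq_zero {g ginv : Ten2 4} (hg : GoodMetric g ginv)
    {ε : ℝ} {u : Vec 4} (hu : UnitVec g ε u) {W : Ten4 4} (hW : IsWeylType ginv W)
    (x y z w : Vec 4) : tangentialDefect W (metricForm g) ε u x y z w = 0 := by
  obtain ⟨hgs, -, -, hgi⟩ := hg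
  obtain ⟨hε, huu⟩ := hu
  obtain ⟨⟨hW34, hW12, -, -⟩, hWt⟩ := hW
  have hε2 : ε * ε = 1 := by rcases hε with rfl | rfl <;> norm_num
  set B := metricForm g with hB
  have hBuu : B u u = ε := by
    rw [← huu, hB, metricForm_apply]
    exact Finset.sum_congr rfl fun i _ => Finset.sum_congr rfl fun j _ => by ring
  have hε0 : ε ≠ 0 := by rintro rfl; simp at hε2
  have hBs : ∀ x y, B x y = B y x := by
    intro x y
    rw [hB, metricForm_apply, metricForm_apply, Finset.sum_comm]
    refine Finset.sum_congr rfl fun i _ => Finset.sum_congr rfl fun j _ => ?_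
    rw [hgs j i]
    ring
  obtain ⟨b, hb0, hb⟩ := exists_orthogonal_basis_zero_eq (m := 3) (by simp) (B := B)
    ⟨fun x y => hBs x y⟩ (x := u) (by rwa [hBuu])
  have hdet : (Matrix.of g).det ≠ 0 := by
    have : Matrix.of g * Matrix.of ginv = 1 := by
      ext i j
      rw [Matrix.mul_apply, Matrix.one_apply]
      exact hgi i j
    exact Matrix.det_ne_zero_of_right_inverse this
  have hd : ∀ i, B (b i) (b i) ≠ 0 := by
    refine fun i => hb.not_isOrtho_basis_self_of_separatingLeft ?_ i
    rw [hB]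
    exact LinearMap.separatingLeft_toLinearMap₂'_iff_det_ne_zero.2 hdet
  have hbd : ∀ i j, B (b i) (b j) = if i = j then B (b i) (b i) else 0 := by
    intro i j
    split_ifs with h
    · rw [h]
    · exact hb h
  have hginv := ginv_eq_sum_of_orthogonal hgi hd hbd
  have htr := sum_quadForm_eq_zero hWt hginv
  have s12 := quadForm_swap_left hW12
  have s34 := quadForm_swap_right hW34
  have hL : ∀ x z w, quadForm W x x z w = 0 := fun x z w => by linarith [s12 x x z w]
  have hR : ∀ x y z, quadForm W x y z z = 0 := fun x y z => by linarith [s34 x y z z]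
  have hp0 : orthProj B ε u u = 0 := by simp [orthProj_apply, hBuu, hε2]
  have hub : ∀ i : Fin 3, B u (b i.succ) = 0 := fun i => by
    rw [← hb0]; exact hb (Fin.succ_ne_zero i).symm
  have hps : ∀ i : Fin 3, orthProj B ε u (b i.succ) = b i.succ := fun i => by
    simp [orthProj_apply, hub]
  have hγ0 : ∀ y, B u y - ε * B u u * B u y = 0 := fun y => by rw [hBuu, hε2]; ring
  have hγ0' : ∀ y, B y u - ε * B u y * B u u = 0 := fun y => by
    rw [hBuu, hBs y u]; linear_combination - B u y * hε2
  have hγs : ∀ i j : Fin 3, B (b i.succ) (b j.succ) - ε * B u (b i.succ) * B u (b j.succ) =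
      if i = j then B (b i.succ) (b i.succ) else 0 := fun i j => by
    rw [hub, hub, hbd]; simp
  have hspat : ∀ i j k l : Fin 3,
      tangentialDefect W B ε u (b i.succ) (b j.succ) (b k.succ) (b l.succ) = 0 := by
    refine eq_zero_of_trace_eq_zero (Q := fun i j k l =>
      tangentialDefect W B ε u (b i.succ) (b j.succ) (b k.succ) (b l.succ))
      (t := fun i => (B (b i.succ) (b i.succ))⁻¹) (fun i => inv_ne_zero (hd _)) ?_ ?_ ?_
    · intro i j k l
      simp only [tangentialDefect]
      rw [s12 (orthProj B ε u (b i.succ))]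
      ring
    · intro i j k l
      simp only [tangentialDefect]
      rw [s34 _ _ (orthProj B ε u (b k.succ))]
      ring
    · intro j l
      have hu0 := htr (b j.succ) (b l.succ)
      have huu := htr u u
      rw [Fin.sum_univ_succ, hb0, hBuu] at hu0 huu
      have hflip : ∀ x, quadForm W x u x u = quadForm W u x u x := fun x => by
        rw [s12, s34, neg_neg]
      have hεi : ε⁻¹ = ε := inv_eq_of_mul_eq_one_left hε2
      have hcanc : ∀ i : Fin 3, (B (b i.succ) (b i.succ))⁻¹ * B (b i.succ) (b i.succ) = 1 :=
        fun i => inv_mul_cancel₀ (hd _)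
      simp only [tangentialDefect, hps, hγs, hflip, hL, hεi, Fin.sum_univ_three] at hu0 huu ⊢
      have c0 := hcanc 0
      have c1 := hcanc 1
      have c2 := hcanc 2
      fin_cases j <;> fin_cases l <;> simp at hu0 huu c0 c1 c2 ⊢ <;> grind
  refine eq_zero_of_isLinearMap_of_basis b
    (isLinearMap_tangentialDefect_first W B ε u y z w) (fun i => ?_) x
  refine eq_zero_of_isLinearMap_of_basis b
    (isLinearMap_tangentialDefect_second W B ε u _ z w) (fun j => ?_) y
  refine eq_zero_of_isLinearMap_of_basis b
    (isLinearMap_tangentialDefect_third W B ε u _ _ w) (fun k => ?_) z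
  refine eq_zero_of_isLinearMap_of_basis b
    (isLinearMap_tangentialDefect_fourth W B ε u _ _ _) (fun l => ?_) w
  refine Fin.cases ?_ (fun i => ?_) i
  · simp [tangentialDefect, hb0, hp0, hL, hγ0]
  refine Fin.cases ?_ (fun j => ?_) j
  · simp [tangentialDefect, hb0, hp0, hL, hγ0]
  refine Fin.cases ?_ (fun k => ?_) k
  · simp [tangentialDefect, hb0, hp0, hR, hγ0']
  refine Fin.cases ?_ (fun l => ?_) l
  · simp [tangentialDefect, hb0, hp0, hR, hγ0']
  exact hspat i j k l

/-- equation `eqweylpar4d`: in dimension four, for a Weyl-type tensor `W`,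
the fully tangential projection is determined by the `⊥` component: `W^∥ = −ε W^⊥ ∧ γ`. -/
theorem stmt15 {n : ℕ} (hn4 : n = 4) (g ginv : Ten2 n) (hg : GoodMetric g ginv)
    (ε : ℝ) (u : Vec n) (hu : UnitVec g ε u)
    (W : Ten4 n) (hW : IsWeylType ginv W) :
    ∀ α β μ ν, par4 g ε u W α β μ ν = - ε * KN (perp u W) (gam g ε u) α β μ ν := by
  subst hn4
  intro α β μ ν
  have h := tangentialDefect_eq_zero hg hu hW
    (Pi.single α 1) (Pi.single β 1) (Pi.single μ 1) (Pi.single ν 1)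
  simp only [tangentialDefect, metricForm_single_right hg.1, lower_single hg.1,
    ← perp_eq_quadForm, ← par4_eq_quadForm hg.1] at h
  simp only [KN, gam]
  linear_combination h

end Decomp
end
end

section
/- Let W ∈ W(V). Writing W^{⊥∥}_{(μ|α|ν)} := (1/2)(W^{⊥∥}_{μαν} + W^{⊥∥}_{ναμ}), the algebraic type conditions expressed in the semi-null frame built from u, y, k, l, h are equivalent to the following tensor equations: (i) W_{αμβν} k^α h^μ_{μ'} k^β h^ν_{ν'} = 0 for all μ', ν' if and only if W^⊥_{μν} h^μ_{μ'} h^ν_{ν'} + 2 W^{⊥∥}_{(μ|α|ν)} y^α h^μ_{μ'} h^ν_{ν'} + W^∥_{αμβν} y^α y^β h^μ_{μ'} h^ν_{ν'} = 0; (ii) W_{αμβν} k^α l^μ k^β h^ν_{ν'} = 0 for all ν' if and only if W^⊥_{μν} y^μ h^ν_{ν'} + W^{⊥∥}_{αβν} y^α y^β h^ν_{ν'} = 0; (iii) W_{αμβν} k^α h^μ_{μ'} h^β_{β'} h^ν_{ν'} = 0 for all μ', β', ν' if and only if W^{⊥∥}_{μβν} h^μ_{μ'} h^β_{β'} h^ν_{ν'}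 + W^∥_{αμβν} y^α h^μ_{μ'} h^β_{β'} h^ν_{ν'} = 0. -/
open scoped BigOperators

noncomputable section

namespace Decomp

variable {n : ℕ}

/-- The full contraction `T(a, b, c, d)` of a (0,4)-tensor. -/
def eval4 (T : Ten4 n) (a b c d : Vec n) : ℝ :=
  ∑ α, ∑ μ, ∑ β, ∑ ν, a α * b μ * c β * d ν * T α μ β ν

/-- The full contraction `F(a, b, c)` of a (0,3)-tensor. -/
def eval3 (F : Ten3 n) (a b c : Vec n) : ℝ :=
  ∑ α, ∑ β, ∑ ν, a α * b β * c ν * F α β ν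

lemma eval4_add_left (T : Ten4 n) (a a' b c d : Vec n) :
    eval4 T (a + a') b c d = eval4 T a b c d + eval4 T a' b c d := by
  simp only [eval4, Pi.add_apply, add_mul, Finset.sum_add_distrib]

lemma eval4_smul_left (T : Ten4 n) (r : ℝ) (a b c d : Vec n) :
    eval4 T (r • a) b c d = r * eval4 T a b c d := by
  simp only [eval4, Pi.smul_apply, smul_eq_mul, Finset.mul_sum, mul_assoc]

lemma eval4_rotate (T : Ten4 n) (a b c d : Vec n) :
    eval4 T a b c d = eval4 (fun ν α μ β => T α μ β ν) d a b c := by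
  unfold eval4
  calc _ = ∑ α, ∑ μ, ∑ ν, ∑ β, a α * b μ * c β * d ν * T α μ β ν :=
        Finset.sum_congr rfl fun _ _ => Finset.sum_congr rfl fun _ _ => Finset.sum_comm
    _ = ∑ α, ∑ ν, ∑ μ, ∑ β, a α * b μ * c β * d ν * T α μ β ν :=
        Finset.sum_congr rfl fun _ _ => Finset.sum_comm
    _ = ∑ ν, ∑ α, ∑ μ, ∑ β, a α * b μ * c β * d ν * T α μ β ν := Finset.sum_comm
    _ = _ := by
        refine Finset.sum_congr rfl fun _ _ => Finset.sum_congr rfl fun _ _ =>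
          Finset.sum_congr rfl fun _ _ => Finset.sum_congr rfl fun _ _ => ?_
        ring

lemma eval4_swap_pairs {T : Ten4 n} (hT : IsRiemannType T) (a b c d : Vec n) :
    eval4 T a b c d = eval4 T c d a b := by
  rw [eval4_rotate, eval4_rotate]
  congr 1
  funext α β μ ν
  exact hT.2.2.1 μ ν α β

lemma eval4_swap_left {T : Ten4 n} (hT : IsRiemannType T) (a b c d : Vec n) :
    eval4 T a b c d = -eval4 T b a c d := by
  unfold eval4
  rw [Finset.sum_comm]
  simp only [← Finset.sum_neg_distrib]
  refine Finset.sum_congr rfl fun μ _ => Finset.sum_congr rfl fun α _ =>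
    Finset.sum_congr rfl fun β _ => Finset.sum_congr rfl fun ν _ => ?_
  rw [hT.2.1 α μ β ν]
  ring

/-- Transforming the last slot by `A` is the same as transforming the last argument. -/
lemma eval4_last_of_fixed (T : Ten4 n) (A : Ten2 n) (a b c d : Vec n)
    (hd : ∀ ρ, ∑ x, A ρ x * d x = d ρ) :
    eval4 (fun α β μ ν => ∑ ρ, A ρ ν * T α β μ ρ) a b c d = eval4 T a b c d := by
  unfold eval4
  refine Finset.sum_congr rfl fun α _ => Finset.sum_congr rfl fun β _ =>
    Finset.sum_congr rfl fun μ _ => ?_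
  simp only [Finset.mul_sum]
  rw [Finset.sum_comm]
  refine Finset.sum_congr rfl fun ρ _ => ?_
  conv_rhs => rw [← hd ρ]
  rw [Finset.mul_sum, Finset.sum_mul]
  refine Finset.sum_congr rfl fun ν _ => ?_
  ring

lemma eval4_third_of_fixed (T : Ten4 n) (A : Ten2 n) (a b c d : Vec n)
    (hc : ∀ ρ, ∑ x, A ρ x * c x = c ρ) :
    eval4 (fun α β μ ν => ∑ ρ, A ρ μ * T α β ρ ν) a b c d = eval4 T a b c d := by
  rw [eval4_rotate, eval4_rotate T]
  exact eval4_last_of_fixed (fun ν α β μ => T α β μ ν) A d a b c hc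

lemma eval4_second_of_fixed (T : Ten4 n) (A : Ten2 n) (a b c d : Vec n)
    (hb : ∀ ρ, ∑ x, A ρ x * b x = b ρ) :
    eval4 (fun α β μ ν => ∑ ρ, A ρ β * T α ρ μ ν) a b c d = eval4 T a b c d := by
  rw [eval4_rotate, eval4_rotate T]
  exact eval4_third_of_fixed (fun ν α β μ => T α β μ ν) A d a b c hb

lemma eval4_first_of_fixed (T : Ten4 n) (A : Ten2 n) (a b c d : Vec n)
    (ha : ∀ ρ, ∑ x, A ρ x * a x = a ρ) :
    eval4 (fun α β μ ν => ∑ ρ, A ρ α * T ρ β μ ν) a b c d = eval4 T a b c d := by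
  rw [eval4_rotate, eval4_rotate T]
  exact eval4_second_of_fixed (fun ν α β μ => T α β μ ν) A d a b c ha

lemma eval3_contract_first (T : Ten4 n) (u a b c : Vec n) :
    eval3 (fun β μ ν => ∑ α, u α * T α β μ ν) a b c = eval4 T u a b c := by
  rw [eval4_rotate, eval4_rotate, eval4_rotate]
  unfold eval3 eval4
  simp only [Finset.mul_sum]
  refine Finset.sum_congr rfl fun β _ => Finset.sum_congr rfl fun μ _ =>
    Finset.sum_congr rfl fun ν _ => Finset.sum_congr rfl fun α _ => ?_
  ring

lemma eval3_perppar (g : Ten2 n) (ε : ℝ) (u : Vec n) (T : Ten4 n) (a b c : Vec n)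
    (hb : ∀ ρ, ∑ x, gamMix g ε u ρ x * b x = b ρ)
    (hc : ∀ ρ, ∑ x, gamMix g ε u ρ x * c x = c ρ) :
    eval3 (perppar g ε u T) a b c = eval4 T u a b c := by
  rw [← eval4_last_of_fixed T _ u a b c hc, ← eval4_third_of_fixed _ _ u a b c hb,
    ← eval3_contract_first]
  congr 1
  funext β μ ν
  simp only [perppar, Finset.mul_sum, mul_assoc]

lemma eval4_par4 (g : Ten2 n) (ε : ℝ) (u : Vec n) (T : Ten4 n) (a b c d : Vec n)
    (ha : ∀ ρ, ∑ x, gamMix g ε u ρ x * a x = a ρ)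
    (hb : ∀ ρ, ∑ x, gamMix g ε u ρ x * b x = b ρ)
    (hc : ∀ ρ, ∑ x, gamMix g ε u ρ x * c x = c ρ)
    (hd : ∀ ρ, ∑ x, gamMix g ε u ρ x * d x = d ρ) :
    eval4 (par4 g ε u T) a b c d = eval4 T a b c d := by
  refine Eq.trans ?_ (eval4_last_of_fixed T _ a b c d hd)
  refine Eq.trans ?_ (eval4_third_of_fixed _ _ a b c d hc)
  refine Eq.trans ?_ (eval4_second_of_fixed _ _ a b c d hb)
  refine Eq.trans ?_ (eval4_first_of_fixed _ _ a b c d ha)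
  congr 1
  funext α β μ ν
  simp only [par4, Finset.mul_sum, mul_assoc]

lemma sum_perp (u : Vec n) (T : Ten4 n) (b d : Vec n) :
    ∑ μ, ∑ ν, perp u T μ ν * b μ * d ν = eval4 T u b u d := by
  rw [eval4_rotate, eval4_rotate, eval4_rotate]
  unfold perp eval4
  refine Finset.sum_congr rfl fun β _ => ?_
  simp only [Finset.sum_mul]
  calc _ = ∑ ν, ∑ μ, ∑ α, u α * u μ * T α β μ ν * b β * d ν :=
        (Finset.sum_congr rfl fun _ _ => Finset.sum_comm)
    _ = ∑ μ, ∑ ν, ∑ α, u α * u μ * T α β μ ν * b β * d ν := Finset.sum_comm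
    _ = _ := by
        refine Finset.sum_congr rfl fun μ _ => Finset.sum_congr rfl fun ν _ =>
          Finset.sum_congr rfl fun α _ => ?_
        ring

lemma eval3_reverse (F : Ten3 n) (a b c : Vec n) :
    eval3 (fun α β ν => F ν β α) a b c = eval3 F c b a := by
  unfold eval3
  calc _ = ∑ α, ∑ ν, ∑ β, a α * b β * c ν * F ν β α :=
        Finset.sum_congr rfl fun _ _ => Finset.sum_comm
    _ = ∑ ν, ∑ α, ∑ β, a α * b β * c ν * F ν β α := Finset.sum_comm
    _ = ∑ ν, ∑ β, ∑ α, a α * b β * c ν * F ν β α :=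
        Finset.sum_congr rfl fun _ _ => Finset.sum_comm
    _ = _ := by
        refine Finset.sum_congr rfl fun _ _ => Finset.sum_congr rfl fun _ _ =>
          Finset.sum_congr rfl fun _ _ => ?_
        ring

lemma two_mul_sum_symmetrized (F : Ten3 n) (a b c : Vec n) :
    2 * ∑ μ, ∑ α, ∑ ν, ((F μ α ν + F ν α μ) / 2) * b α * a μ * c ν
      = eval3 F a b c + eval3 F c b a := by
  rw [← eval3_reverse F a b c]
  simp only [eval3, Finset.mul_sum, ← Finset.sum_add_distrib]
  refine Finset.sum_congr rfl fun _ _ => Finset.sum_congr rfl fun _ _ =>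
    Finset.sum_congr rfl fun _ _ => ?_
  ring

lemma gamMix_fixes (g : Ten2 n) (ε : ℝ) (u v : Vec n) (hv : ∑ x, lower g u x * v x = 0)
    (ρ : Fin n) : ∑ x, gamMix g ε u ρ x * v x = v ρ := by
  have h : ∀ x, gamMix g ε u ρ x * v x
      = (if ρ = x then v x else 0) - ε * u ρ * (lower g u x * v x) := by
    intro x
    unfold gamMix
    split_ifs <;> ring
  simp only [h, Finset.sum_sub_distrib, ← Finset.mul_sum, hv]
  simp

lemma sum_lower_mul {g : Ten2 n} (hg : ∀ α β, g α β = g β α) (a b : Vec n) :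
    ∑ x, lower g a x * b x = ∑ α, ∑ β, g α β * a α * b β := by
  simp only [lower, Finset.sum_mul]
  rw [Finset.sum_comm]
  refine Finset.sum_congr rfl fun α _ => Finset.sum_congr rfl fun β _ => ?_
  rw [hg β α]

lemma sum_lower_mul_hMix {g : Ten2 n} {ε : ℝ} {u y : Vec n} (hε : ε * ε = 1)
    (huu : ∑ x, lower g u x * u x = ε) (huy : ∑ x, lower g u x * y x = 0) (μ' : Fin n) :
    ∑ x, lower g u x * hMix g ε u y x μ' = 0 := by
  have h : ∀ x, lower g u x * hMix g ε u y x μ'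
      = (if x = μ' then lower g u x else 0) - ε * lower g u μ' * (lower g u x * u x)
        + ε * lower g y μ' * (lower g u x * y x) := by
    intro x
    unfold hMix gamMix
    split_ifs <;> ring
  simp only [h, Finset.sum_add_distrib, Finset.sum_sub_distrib, ← Finset.mul_sum, huu, huy]
  simp only [Finset.sum_ite_eq', Finset.mem_univ, if_true]
  linear_combination -(lower g u μ') * hε

lemma eval4_kkhh {T : Ten4 n} (hT : IsRiemannType T) (s : ℝ) (u y p q : Vec n) :
    eval4 T (s • (u + y)) p (s • (u + y)) q
      = s ^ 2 * (eval4 T u p u q + (eval4 T u p y q + eval4 T u q y p) + eval4 T y p y q) := by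
  rw [eval4_smul_left, eval4_swap_pairs hT, eval4_smul_left]
  simp only [eval4_add_left]
  rw [eval4_swap_pairs hT u q (u + y) p, eval4_swap_pairs hT y q (u + y) p]
  simp only [eval4_add_left]
  rw [eval4_swap_pairs hT y p u q]
  ring

lemma eval4_klkh {T : Ten4 n} (hT : IsRiemannType T) (s t : ℝ) (u y q : Vec n) :
    eval4 T (s • (u + y)) (t • (u - y)) (s • (u + y)) q
      = -2 * s ^ 2 * t * (eval4 T u y u q + eval4 T u y y q) := by
  have hsub : u - y = u + (-1 : ℝ) • y := by
    funext i
    simp [sub_eq_add_neg]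
  have hself : ∀ a c : Vec n, eval4 T a a c q = 0 := fun a c => by
    linarith [eval4_swap_left hT a a c q]
  have hlin : ∀ a b : Vec n, eval4 T a b (u + y) q = eval4 T a b u q + eval4 T a b y q := by
    intro a b
    rw [eval4_swap_pairs hT, eval4_add_left, eval4_swap_pairs hT u, eval4_swap_pairs hT y]
  rw [eval4_smul_left, eval4_swap_left hT, eval4_smul_left, eval4_swap_pairs hT,
    eval4_smul_left, eval4_swap_pairs hT, hsub, eval4_add_left, eval4_smul_left,
    eval4_swap_left hT u (u + y), eval4_swap_left hT y (u + y)]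
  simp only [eval4_add_left, hlin, hself]
  rw [eval4_swap_left hT y u, eval4_swap_left hT y u]
  ring

/-- equations `eqtypeI5d`, `eqtypeII5d`, `eqtypeII5d2`: the algebraic type
conditions in the semi-null frame built from `u, y, k, l, h` are equivalent to tensor
equations for the components of the Weyl-type tensor `W` with respect to `u`. -/
theorem stmt16 {n : ℕ} (hn : 4 ≤ n) (g ginv : Ten2 n) (hg : GoodMetric g ginv)
    (ε : ℝ) (u : Vec n) (hu : UnitVec g ε u)
    (y : Vec n) (hyu : (∑ α, ∑ β, g α β * u α * y β) = 0)
    (hy : (∑ α, ∑ β, g α β * y α * y β) = -ε)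
    (s : ℝ) (hs : s ≠ 0)
    (W : Ten4 n) (hW : IsWeylType ginv W) :
    ((∀ μ' ν',
        (∑ α, ∑ μ, ∑ β, ∑ ν, (s * (u α + y α)) * hMix g ε u y μ μ' *
          (s * (u β + y β)) * hMix g ε u y ν ν' * W α μ β ν) = 0) ↔
      (∀ μ' ν',
        (∑ μ, ∑ ν, perp u W μ ν * hMix g ε u y μ μ' * hMix g ε u y ν ν')
        + 2 * (∑ μ, ∑ α, ∑ ν, ((perppar g ε u W μ α ν + perppar g ε u W ν α μ) / 2) *
            y α * hMix g ε u y μ μ' * hMix g ε u y ν ν')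
        + (∑ α, ∑ μ, ∑ β, ∑ ν, par4 g ε u W α μ β ν * y α * y β *
            hMix g ε u y μ μ' * hMix g ε u y ν ν') = 0)) ∧
    ((∀ ν',
        (∑ α, ∑ μ, ∑ β, ∑ ν, (s * (u α + y α)) * (-(ε / 2) * s⁻¹ * (u μ - y μ)) *
          (s * (u β + y β)) * hMix g ε u y ν ν' * W α μ β ν) = 0) ↔
      (∀ ν',
        (∑ μ, ∑ ν, perp u W μ ν * y μ * hMix g ε u y ν ν')
        + (∑ α, ∑ β, ∑ ν, perppar g ε u W α β ν * y α * y β * hMix g ε u y ν ν') = 0)) ∧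
    ((∀ μ' β' ν',
        (∑ α, ∑ μ, ∑ β, ∑ ν, (s * (u α + y α)) * hMix g ε u y μ μ' *
          hMix g ε u y β β' * hMix g ε u y ν ν' * W α μ β ν) = 0) ↔
      (∀ μ' β' ν',
        (∑ μ, ∑ β, ∑ ν, perppar g ε u W μ β ν *
          hMix g ε u y μ μ' * hMix g ε u y β β' * hMix g ε u y ν ν')
        + (∑ α, ∑ μ, ∑ β, ∑ ν, par4 g ε u W α μ β ν * y α *
            hMix g ε u y μ μ' * hMix g ε u y β β' * hMix g ε u y ν ν') = 0)) := by
  obtain ⟨hε1, huu⟩ := hu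
  have hε : ε * ε = 1 := by rcases hε1 with rfl | rfl <;> norm_num
  have hε0 : ε ≠ 0 := left_ne_zero_of_mul_eq_one hε
  rw [← sum_lower_mul hg.1] at huu hyu
  have hR := hW.1
  have fy := gamMix_fixes g ε u y hyu
  have fh : ∀ μ', ∀ ρ, ∑ x, gamMix g ε u ρ x * hMix g ε u y x μ' = hMix g ε u y ρ μ' :=
    fun μ' => gamMix_fixes g ε u (fun x => hMix g ε u y x μ')
      (sum_lower_mul_hMix hε huu hyu μ')
  refine ⟨forall_congr' fun μ' => forall_congr' fun ν' => ?_, forall_congr' fun ν' => ?_,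
    forall_congr' fun μ' => forall_congr' fun β' => forall_congr' fun ν' => ?_⟩
  · have hpar := eval4_par4 g ε u W y (fun x => hMix g ε u y x μ') y
      (fun x => hMix g ε u y x ν') fy (fh μ') fy (fh ν')
    have hl := eval4_kkhh hR s u y (fun x => hMix g ε u y x μ') (fun x => hMix g ε u y x ν')
    rw [sum_perp u W (fun x => hMix g ε u y x μ') (fun x => hMix g ε u y x ν'),
      two_mul_sum_symmetrized (perppar g ε u W) (fun x => hMix g ε u y x μ') y
        (fun x => hMix g ε u y x ν'),
      eval3_perppar g ε u W _ _ _ fy (fh ν'), eval3_perppar g ε u W _ _ _ fy (fh μ')]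
    have hr : ∑ α, ∑ μ, ∑ β, ∑ ν, par4 g ε u W α μ β ν * y α * y β *
        hMix g ε u y μ μ' * hMix g ε u y ν ν'
        = eval4 W y (fun x => hMix g ε u y x μ') y (fun x => hMix g ε u y x ν') := by
      rw [← hpar]
      refine Finset.sum_congr rfl fun _ _ => Finset.sum_congr rfl fun _ _ =>
        Finset.sum_congr rfl fun _ _ => Finset.sum_congr rfl fun _ _ => ?_
      ring
    rw [hr]
    change eval4 W (s • (u + y)) (fun x => hMix g ε u y x μ') (s • (u + y))
      (fun x => hMix g ε u y x ν') = 0 ↔ _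
    rw [hl, mul_eq_zero, or_iff_right (pow_ne_zero 2 hs)]
  · have hpp := eval3_perppar g ε u W y y (fun x => hMix g ε u y x ν') fy (fh ν')
    have hr : ∑ α, ∑ β, ∑ ν, perppar g ε u W α β ν * y α * y β * hMix g ε u y ν ν'
        = eval4 W u y y (fun x => hMix g ε u y x ν') := by
      rw [← hpp]
      refine Finset.sum_congr rfl fun _ _ => Finset.sum_congr rfl fun _ _ =>
        Finset.sum_congr rfl fun _ _ => ?_
      ring
    rw [hr, sum_perp u W y (fun x => hMix g ε u y x ν')]
    change eval4 W (s • (u + y)) ((-(ε / 2) * s⁻¹) • (u - y)) (s • (u + y))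
      (fun x => hMix g ε u y x ν') = 0 ↔ _
    have hc : -2 * s ^ 2 * (-(ε / 2) * s⁻¹) ≠ 0 := by
      simp [hs, hε0]
    rw [eval4_klkh hR, mul_eq_zero, or_iff_right hc]
  · have hpp := eval3_perppar g ε u W (fun x => hMix g ε u y x μ')
      (fun x => hMix g ε u y x β') (fun x => hMix g ε u y x ν') (fh β') (fh ν')
    have hpar := eval4_par4 g ε u W y (fun x => hMix g ε u y x μ')
      (fun x => hMix g ε u y x β') (fun x => hMix g ε u y x ν') fy (fh μ') (fh β') (fh ν')
    have hr₁ : ∑ μ, ∑ β, ∑ ν, perppar g ε u W μ β ν *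
        hMix g ε u y μ μ' * hMix g ε u y β β' * hMix g ε u y ν ν'
        = eval4 W u (fun x => hMix g ε u y x μ') (fun x => hMix g ε u y x β')
          (fun x => hMix g ε u y x ν') := by
      rw [← hpp]
      refine Finset.sum_congr rfl fun _ _ => Finset.sum_congr rfl fun _ _ =>
        Finset.sum_congr rfl fun _ _ => ?_
      ring
    have hr₂ : ∑ α, ∑ μ, ∑ β, ∑ ν, par4 g ε u W α μ β ν * y α *
        hMix g ε u y μ μ' * hMix g ε u y β β' * hMix g ε u y ν ν'
        = eval4 W y (fun x => hMix g ε u y x μ') (fun x => hMix g ε u y x β')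
          (fun x => hMix g ε u y x ν') := by
      rw [← hpar]
      refine Finset.sum_congr rfl fun _ _ => Finset.sum_congr rfl fun _ _ =>
        Finset.sum_congr rfl fun _ _ => Finset.sum_congr rfl fun _ _ => ?_
      ring
    rw [hr₁, hr₂]
    change eval4 W (s • (u + y)) (fun x => hMix g ε u y x μ') (fun x => hMix g ε u y x β')
      (fun x => hMix g ε u y x ν') = 0 ↔ _
    rw [eval4_smul_left, eval4_add_left, mul_eq_zero, or_iff_right hs]

end Decomp
end
end
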